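/- arXiv:1701.07691 — 2 statements merged into one kernel-verified Lean document; each statement's English description precedes it below -/
import Mathlib

section
/- Let d ≥ 1, s > 0, E ⊆ ℝ^d be a non-degenerate parallelepiped, and let c : Λ'_E → ℂ satisfy |c(α)| ≤ C e^{-r|α|^{1/s}} for all α ∈ Λ'_E, for some constants C, r > 0. Then the series f(x) = Σ_{α∈Λ'_E} c(α) e^{i⟨x,α⟩} converges absolutely and uniformly on ℝ^d, its sum f is a smooth E-periodic function whose derivatives are obtained by termwise differentiation, c(f,α) = c(α) for every α ∈ Λ'_E, and there exist constants C', h > 0 such that ‖∂^β f‖_{L^∞(ℝ^d)} ≤ C' h^{|β|} (β!)^s for every multi-index β. -/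
open MeasureTheory Filter
open scoped BigOperators InnerProductSpace Topology

noncomputable section

abbrev Euc (d : ℕ) := EuclideanSpace ℝ (Fin d)

/-- The lattice point `∑ i, j i • e i` associated with `j : ℤ^d`. -/
def latPt {d : ℕ} (e : Fin d → Euc d) (j : Fin d → ℤ) : Euc d :=
  ∑ i, (j i : ℝ) • e i

/-- The (closed) parallelepiped spanned by `e`. -/
def paraSet {d : ℕ} (e : Fin d → Euc d) : Set (Euc d) :=
  (fun t : Fin d → ℝ => ∑ i, t i • e i) '' (Set.univ.pi fun _ => Set.Icc (0:ℝ) 1)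

/-- Fourier coefficient `c(f, ξ) = |E|⁻¹ ∫_E f(x) e^{-i⟨x,ξ⟩} dx`. -/
def fourCoeff {d : ℕ} (e : Fin d → Euc d) (f : Euc d → ℂ) (ξ : Euc d) : ℂ :=
  (((volume (paraSet e)).toReal : ℂ))⁻¹ *
    ∫ x in paraSet e, f x * Complex.exp (-(Complex.I) * (⟪x, ξ⟫_ℝ : ℂ))

/-- Iterated partial derivatives along a list of coordinate directions. -/
def pdSeq {d : ℕ} : List (Fin d) → (Euc d → ℂ) → (Euc d → ℂ)
  | [], f => f
  | (i :: L), f => pdSeq L (fun x => fderiv ℝ f x (EuclideanSpace.single i 1))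

/-- The canonical list of directions attached to a multi-index `β`. -/
def mIdxL {d : ℕ} (β : Fin d → ℕ) : List (Fin d) :=
  (List.finRange d).flatMap fun i => List.replicate (β i) i

/-- The multi-index partial derivative `∂^β f`. -/
def pD {d : ℕ} (β : Fin d → ℕ) (f : Euc d → ℂ) : Euc d → ℂ := pdSeq (mIdxL β) f

/-- Fourier transform, normalized as `(2π)^{-d/2} ∫ f(x) e^{-i⟨x,ξ⟩} dx`. -/
def FT {d : ℕ} (f : Euc d → ℂ) (ξ : Euc d) : ℂ :=
  (((2 * Real.pi) ^ (-(d:ℝ)/2) : ℝ) : ℂ) *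
    ∫ x, f x * Complex.exp (-(Complex.I) * (⟪x, ξ⟫_ℝ : ℂ))

/-- Short-time Fourier transform with window `φ`. -/
def STFT {d : ℕ} (φ f : Euc d → ℂ) (x ξ : Euc d) : ℂ :=
  (((2 * Real.pi) ^ (-(d:ℝ)/2) : ℝ) : ℂ) *
    ∫ y, f y * (starRingEnd ℂ) (φ (y - x)) * Complex.exp (-(Complex.I) * (⟪y, ξ⟫_ℝ : ℂ))


/-- The (formal) Fourier series `x ↦ Σ_{α ∈ Λ'_E} a(α) e^{i⟨x,α⟩}`. -/
def perSum {d : ℕ} (e' : Fin d → Euc d) (a : (Fin d → ℤ) → ℂ) (x : Euc d) : ℂ :=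
  ∑' ι : Fin d → ℤ, a ι * Complex.exp (Complex.I * (⟪x, latPt e' ι⟫_ℝ : ℂ))

section ExponentialSeries

variable {d : ℕ} {κ : Type*}

/-- The product of the symbols `i ξ_j` of the partial derivatives along a list of directions. -/
def dirSymbol (L : List (Fin d)) (ξ : Euc d) : ℂ :=
  (L.map fun j => Complex.I * (ξ j : ℂ)).prod

/-- Coefficients `b` decaying faster than any power of the norm of the frequencies `ξ`. -/
def RapidDecay (ξ : κ → Euc d) (b : κ → ℂ) : Prop :=
  ∀ n : ℕ, Summable fun k => ‖b k‖ * ‖ξ k‖ ^ n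

theorem norm_exp_I_mul_inner (x ξ : Euc d) :
    ‖Complex.exp (Complex.I * (⟪x, ξ⟫_ℝ : ℂ))‖ = 1 := by
  rw [mul_comm]
  exact Complex.norm_exp_ofReal_mul_I _

theorem hasFDerivAt_mul_exp_I_inner (c : ℂ) (ξ x : Euc d) :
    HasFDerivAt (fun y : Euc d => c * Complex.exp (Complex.I * (⟪y, ξ⟫_ℝ : ℂ)))
      ((c * Complex.exp (Complex.I * (⟪x, ξ⟫_ℝ : ℂ)) * Complex.I) •
        Complex.ofRealCLM.comp (innerSL ℝ ξ)) x := by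
  have h : HasFDerivAt (fun y : Euc d => (⟪y, ξ⟫_ℝ : ℂ))
      (Complex.ofRealCLM.comp (innerSL ℝ ξ)) x := by
    convert (Complex.ofRealCLM.comp (innerSL ℝ ξ)).hasFDerivAt using 2 with y
    simp [real_inner_comm]
  refine ((h.const_mul Complex.I).cexp.const_mul c).congr_fderiv ?_
  simp only [smul_smul, mul_assoc]

theorem norm_dirSymbol_le (L : List (Fin d)) (ξ : Euc d) :
    ‖dirSymbol L ξ‖ ≤ ‖ξ‖ ^ L.length := by
  induction L with
  | nil => simp [dirSymbol]
  | cons i L ih =>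
    have h : ‖(ξ i : ℂ)‖ ≤ ‖ξ‖ := by
      simpa using PiLp.norm_apply_le ξ i
    have := mul_le_mul h ih (norm_nonneg _) (norm_nonneg _)
    simpa [dirSymbol, pow_succ', mul_assoc] using this

theorem RapidDecay.mul_dirSymbol {ξ : κ → Euc d} {b : κ → ℂ} (hb : RapidDecay ξ b)
    (L : List (Fin d)) : RapidDecay ξ fun k => b k * dirSymbol L (ξ k) := by
  intro n
  refine (hb (L.length + n)).of_nonneg_of_le (fun k => by positivity) fun k => ?_
  rw [norm_mul, pow_add, ← mul_assoc]
  gcongr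
  exact norm_dirSymbol_le L (ξ k)

theorem RapidDecay.summable_norm {ξ : κ → Euc d} {b : κ → ℂ} (hb : RapidDecay ξ b) :
    Summable fun k => ‖b k‖ := by
  simpa using hb 0

theorem RapidDecay.summable_norm_mul_exp {ξ : κ → Euc d} {b : κ → ℂ} (hb : RapidDecay ξ b)
    (x : Euc d) :
    Summable fun k => ‖b k * Complex.exp (Complex.I * (⟪x, ξ k⟫_ℝ : ℂ))‖ := by
  simpa only [norm_mul, norm_exp_I_mul_inner, mul_one] using hb.summable_norm

theorem pdSeq_mul_exp_I_inner (L : List (Fin d)) (c : ℂ) (ξ : Euc d) :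
    pdSeq L (fun x : Euc d => c * Complex.exp (Complex.I * (⟪x, ξ⟫_ℝ : ℂ))) =
      fun x => c * dirSymbol L ξ * Complex.exp (Complex.I * (⟪x, ξ⟫_ℝ : ℂ)) := by
  induction L generalizing c with
  | nil => simp [pdSeq, dirSymbol]
  | cons i L ih =>
    have h : (fun x : Euc d => fderiv ℝ
        (fun y : Euc d => c * Complex.exp (Complex.I * (⟪y, ξ⟫_ℝ : ℂ))) x
          (EuclideanSpace.single i 1)) =
        fun x => (c * (Complex.I * (ξ i : ℂ))) *
          Complex.exp (Complex.I * (⟪x, ξ⟫_ℝ : ℂ)) := by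
      funext x
      rw [(hasFDerivAt_mul_exp_I_inner c ξ x).fderiv]
      simp [EuclideanSpace.inner_single_right]
      ring
    rw [pdSeq, h, ih]
    simp [dirSymbol, mul_assoc]

theorem RapidDecay.hasFDerivAt_tsum {ξ : κ → Euc d} {b : κ → ℂ} (hb : RapidDecay ξ b)
    (x : Euc d) :
    HasFDerivAt (fun y : Euc d => ∑' k, b k * Complex.exp (Complex.I * (⟪y, ξ k⟫_ℝ : ℂ)))
      (∑' k, (b k * Complex.exp (Complex.I * (⟪x, ξ k⟫_ℝ : ℂ)) * Complex.I) •
        Complex.ofRealCLM.comp (innerSL ℝ (ξ k))) x ∧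
    Summable fun k => (b k * Complex.exp (Complex.I * (⟪x, ξ k⟫_ℝ : ℂ)) * Complex.I) •
        Complex.ofRealCLM.comp (innerSL ℝ (ξ k)) := by
  have hs : Summable fun k => ‖b k‖ * ‖ξ k‖ := by simpa using hb 1
  have hle : ∀ k (y : Euc d), ‖(b k * Complex.exp (Complex.I * (⟪y, ξ k⟫_ℝ : ℂ)) * Complex.I) •
        Complex.ofRealCLM.comp (innerSL ℝ (ξ k))‖ ≤ ‖b k‖ * ‖ξ k‖ := by
    intro k y
    rw [norm_smul, norm_mul, norm_mul, norm_exp_I_mul_inner, Complex.norm_I, mul_one, mul_one]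
    gcongr
    refine (ContinuousLinearMap.opNorm_comp_le _ _).trans ?_
    simp
  exact ⟨_root_.hasFDerivAt_tsum hs (fun k y => hasFDerivAt_mul_exp_I_inner (b k) (ξ k) y) hle
    (hb.summable_norm_mul_exp 0).of_norm x, hs.of_norm_bounded fun k => hle k x⟩

theorem RapidDecay.fderiv_tsum_single {ξ : κ → Euc d} {b : κ → ℂ} (hb : RapidDecay ξ b)
    (x : Euc d) (i : Fin d) :
    fderiv ℝ (fun y : Euc d => ∑' k, b k * Complex.exp (Complex.I * (⟪y, ξ k⟫_ℝ : ℂ))) x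
        (EuclideanSpace.single i 1) =
      ∑' k, b k * dirSymbol [i] (ξ k) * Complex.exp (Complex.I * (⟪x, ξ k⟫_ℝ : ℂ)) := by
  obtain ⟨h, hs⟩ := hb.hasFDerivAt_tsum x
  rw [h.fderiv, ← ContinuousLinearMap.apply_apply (𝕜 := ℝ) (EuclideanSpace.single i (1 : ℝ)),
    ContinuousLinearMap.map_tsum _ hs]
  refine tsum_congr fun k => ?_
  simp [EuclideanSpace.inner_single_right, dirSymbol]
  ring

theorem RapidDecay.pdSeq_tsum {ξ : κ → Euc d} {b : κ → ℂ} (hb : RapidDecay ξ b)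
    (L : List (Fin d)) :
    pdSeq L (fun y : Euc d => ∑' k, b k * Complex.exp (Complex.I * (⟪y, ξ k⟫_ℝ : ℂ))) =
      fun x => ∑' k, b k * dirSymbol L (ξ k) *
        Complex.exp (Complex.I * (⟪x, ξ k⟫_ℝ : ℂ)) := by
  induction L generalizing b with
  | nil => simp [pdSeq, dirSymbol]
  | cons i L ih =>
    rw [pdSeq, funext fun x => hb.fderiv_tsum_single x i, ih (hb.mul_dirSymbol [i])]
    simp [dirSymbol, mul_assoc]

theorem RapidDecay.contDiff_tsum {ξ : κ → Euc d} {b : κ → ℂ} (hb : RapidDecay ξ b) :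
    ContDiff ℝ (⊤ : ℕ∞)
      fun y : Euc d => ∑' k, b k * Complex.exp (Complex.I * (⟪y, ξ k⟫_ℝ : ℂ)) := by
  refine contDiff_infty.2 fun n => ?_
  induction n generalizing b with
  | zero =>
    exact contDiff_zero.2 <| continuous_iff_continuousAt.2 fun x =>
      (hb.hasFDerivAt_tsum x).1.continuousAt
  | succ n ih =>
    push_cast
    refine contDiff_succ_iff_fderiv.2
      ⟨fun x => (hb.hasFDerivAt_tsum x).1.differentiableAt, by simp, ?_⟩
    refine contDiff_clm_apply_iff.2 fun v => ?_
    have hv : v = ∑ i, v i • EuclideanSpace.single i (1 : ℝ) := by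
      ext j
      simp [Pi.single_apply]
    rw [hv]
    simp only [map_sum, map_smul, hb.fderiv_tsum_single]
    exact ContDiff.sum fun i _ => (ih (hb.mul_dirSymbol [i])).const_smul _

end ExponentialSeries

section DualLattice

variable {d : ℕ} {e e' : Fin d → Euc d}

theorem inner_sum_smul_latPt
    (hdual : ∀ j k, ⟪e j, e' k⟫_ℝ = if j = k then 2 * Real.pi else 0)
    (t : Fin d → ℝ) (ι : Fin d → ℤ) :
    ⟪∑ i, t i • e i, latPt e' ι⟫_ℝ = ∑ i, t i * (2 * Real.pi * ι i) := by
  simp only [latPt, sum_inner, inner_sum, real_inner_smul_left, real_inner_smul_right, hdual,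
    mul_ite, mul_zero, Finset.sum_ite_eq', Finset.mem_univ, if_true]
  exact Finset.sum_congr rfl fun i _ => by ring

theorem latPt_injective
    (hdual : ∀ j k, ⟪e j, e' k⟫_ℝ = if j = k then 2 * Real.pi else 0) :
    Function.Injective (latPt e') := by
  intro ι ι' h
  funext j
  have hj : ∀ m : Fin d → ℤ, ⟪e j, latPt e' m⟫_ℝ = 2 * Real.pi * m j := fun m => by
    simp [latPt, inner_sum, real_inner_smul_right, hdual, mul_comm]
  have := hj ι
  rw [h, hj ι'] at this
  exact_mod_cast (mul_left_cancel₀ Real.two_pi_pos.ne' this).symm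

theorem linearIndependent_of_dual
    (hdual : ∀ j k, ⟪e j, e' k⟫_ℝ = if j = k then 2 * Real.pi else 0) :
    LinearIndependent ℝ e' := by
  rw [Fintype.linearIndependent_iff]
  intro g hg j
  have h : ⟪e j, ∑ i, g i • e' i⟫_ℝ = g j * (2 * Real.pi) := by
    simp [inner_sum, real_inner_smul_right, hdual]
  rw [hg, inner_zero_right] at h
  exact (mul_eq_zero.1 h.symm).resolve_right Real.two_pi_pos.ne'

theorem exists_summable_norm_latPt_inv_pow (he' : LinearIndependent ℝ e')
    (hinj : Function.Injective (latPt e')) :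
    ∃ n : ℕ, Summable fun ι : Fin d → ℤ => ‖latPt e' ι‖⁻¹ ^ n := by
  obtain ⟨b, hb⟩ : ∃ b : Module.Basis (Fin d) ℝ (Euc d), ⇑b = e' :=
    ⟨basisOfLinearIndependentOfCardEqFinrank' e' he' (by simp), by simp⟩
  have hmem : ∀ ι, latPt e' ι ∈ Submodule.span ℤ (Set.range b) := fun ι => by
    refine Submodule.sum_mem _ fun i _ => ?_
    rw [Int.cast_smul_eq_zsmul]
    exact Submodule.smul_mem _ _ (Submodule.subset_span ⟨i, by rw [hb]⟩)
  have hsum := ZLattice.summable_norm_pow_inv (L := Submodule.span ℤ (Set.range b))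
    (Module.finrank ℤ (Submodule.span ℤ (Set.range b)) + 1) (Nat.lt_succ_self _)
  generalize Module.finrank ℤ (Submodule.span ℤ (Set.range b)) + 1 = n at hsum
  have hF : Function.Injective fun ι => (⟨latPt e' ι, hmem ι⟩ : Submodule.span ℤ (Set.range b)) :=
    fun ι ι' h => hinj (congrArg Subtype.val h)
  have h := hsum.comp_injective hF
  refine ⟨n, ?_⟩
  simpa only [Function.comp_def, Submodule.coe_norm] using h

end DualLattice

/-- The elementary inequality behind the Gevrey estimate. -/
theorem pow_sum_le_factorial_rpow_mul_exp {d : ℕ} (hd : 1 ≤ d) {s t y : ℝ} (hs : 0 < s)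
    (ht : 0 < t) (hy : 0 ≤ y) (β : Fin d → ℕ) :
    y ^ (∑ i, β i) ≤ ((d * s / t) ^ s) ^ (∑ i, β i) *
      ((∏ i, (β i).factorial : ℕ) : ℝ) ^ s * Real.exp (t * y ^ (1 / s)) := by
  have hd' : (0 : ℝ) < d := by exact_mod_cast hd
  set u := y ^ (1 / s) with hu
  have hu0 : 0 ≤ u := Real.rpow_nonneg hy _
  have huy : u ^ s = y := by
    rw [hu, ← Real.rpow_mul hy, one_div_mul_cancel hs.ne', Real.rpow_one]
  set δ := t / (d * s) with hδ
  have hδ0 : 0 < δ := by positivity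
  have hle : (δ * u) ^ (∑ i, β i) ≤
      ((∏ i, (β i).factorial : ℕ) : ℝ) * Real.exp (t * u / s) := by
    have hexp : Real.exp (t * u / s) = ∏ _i : Fin d, Real.exp (δ * u) := by
      rw [Finset.prod_const, Finset.card_univ, Fintype.card_fin, ← Real.exp_nat_mul, hδ]
      congr 1
      field_simp
    rw [← Finset.prod_pow_eq_pow_sum, hexp, Nat.cast_prod, ← Finset.prod_mul_distrib]
    refine Finset.prod_le_prod (fun i _ => by positivity) fun i _ => ?_
    have := Real.pow_div_factorial_le_exp (δ * u) (mul_nonneg hδ0.le hu0) (β i)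
    rwa [div_le_iff₀' (by positivity)] at this
  have hpow := Real.rpow_le_rpow (by positivity) hle hs.le
  rw [← Real.rpow_pow_comm (by positivity), Real.mul_rpow hδ0.le hu0, huy,
    Real.mul_rpow (by positivity) (Real.exp_pos _).le, ← Real.exp_mul,
    div_mul_cancel₀ _ hs.ne', mul_pow] at hpow
  have hinv : (d * s / t) ^ s = (δ ^ s)⁻¹ := by
    rw [← Real.inv_rpow hδ0.le, hδ, inv_div]
  rw [hinv, inv_pow, mul_assoc, le_inv_mul_iff₀ (by positivity)]
  exact hpow

section GevreyCoefficients

variable {d : ℕ} {e' : Fin d → Euc d} {s : ℝ}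

theorem summable_exp_neg_norm_latPt_rpow (hs : 0 < s) (he' : LinearIndependent ℝ e')
    (hinj : Function.Injective (latPt e')) {t : ℝ} (ht : 0 < t) :
    Summable fun ι : Fin d → ℤ => Real.exp (-t * ‖latPt e' ι‖ ^ (1 / s)) := by
  obtain ⟨n, hn⟩ := exists_summable_norm_latPt_inv_pow he' hinj
  set K : ℝ := ((1 * s / t) ^ s) ^ n * (n.factorial : ℝ) ^ s with hK
  refine (hn.mul_left K).of_norm_bounded_eventually ?_
  refine (Set.finite_singleton (0 : Fin d → ℤ)).subset fun ι hι => ?_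
  by_contra h0
  have hpos : 0 < ‖latPt e' ι‖ := by
    refine norm_pos_iff.2 fun h => h0 (hinj (h.trans ?_))
    simp [latPt]
  refine hι ?_
  change ‖Real.exp _‖ ≤ _
  have h := pow_sum_le_factorial_rpow_mul_exp le_rfl hs ht hpos.le fun _ : Fin 1 => n
  simp only [Finset.univ_unique, Finset.sum_const, Finset.prod_const, Finset.card_singleton,
    one_smul, pow_one, Nat.cast_one, ← hK] at h
  rw [Real.norm_of_nonneg (Real.exp_pos _).le, neg_mul, Real.exp_neg, inv_pow,
    inv_le_iff_one_le_mul₀ (Real.exp_pos _)]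
  rw [mul_assoc, mul_comm (_⁻¹), ← mul_assoc, ← div_eq_mul_inv, one_le_div (by positivity)]
  exact h

theorem norm_mul_pow_sum_le (hd : 1 ≤ d) (hs : 0 < s) {a : (Fin d → ℤ) → ℂ} {C r : ℝ}
    (hC : 0 < C) (hr : 0 < r)
    (ha : ∀ ι : Fin d → ℤ, ‖a ι‖ ≤ C * Real.exp (-r * ‖latPt e' ι‖ ^ (1 / s)))
    (β : Fin d → ℕ) (ι : Fin d → ℤ) :
    ‖a ι‖ * ‖latPt e' ι‖ ^ (∑ i, β i) ≤
      C * ((d * s / (r / 2)) ^ s) ^ (∑ i, β i) * ((∏ i, (β i).factorial : ℕ) : ℝ) ^ s *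
        Real.exp (-(r / 2) * ‖latPt e' ι‖ ^ (1 / s)) := by
  refine (mul_le_mul (ha ι) (pow_sum_le_factorial_rpow_mul_exp hd hs (half_pos hr)
    (norm_nonneg (latPt e' ι)) β) (by positivity) (by positivity)).trans_eq ?_
  have : Real.exp (-(r / 2) * ‖latPt e' ι‖ ^ (1 / s)) =
      Real.exp (-r * ‖latPt e' ι‖ ^ (1 / s)) * Real.exp (r / 2 * ‖latPt e' ι‖ ^ (1 / s)) := by
    rw [← Real.exp_add]
    ring_nf
  rw [this]
  ring

theorem rapidDecay_of_gevrey (hd : 1 ≤ d) (hs : 0 < s) (he' : LinearIndependent ℝ e')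
    (hinj : Function.Injective (latPt e')) {a : (Fin d → ℤ) → ℂ} {C r : ℝ}
    (hC : 0 < C) (hr : 0 < r)
    (ha : ∀ ι : Fin d → ℤ, ‖a ι‖ ≤ C * Real.exp (-r * ‖latPt e' ι‖ ^ (1 / s))) :
    RapidDecay (latPt e') a := by
  intro n
  have hle := norm_mul_pow_sum_le hd hs hC hr ha (Pi.single ⟨0, hd⟩ n)
  simp only [Finset.sum_pi_single', Finset.mem_univ, if_true] at hle
  exact Summable.of_nonneg_of_le (fun ι => by positivity) hle
    ((summable_exp_neg_norm_latPt_rpow hs he' hinj (half_pos hr)).mul_left _)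

end GevreyCoefficients

theorem length_mIdxL {d : ℕ} (β : Fin d → ℕ) : (mIdxL β).length = ∑ i, β i := by
  simp [mIdxL, List.length_flatMap, List.sum_ofFn, ← List.ofFn_eq_map]

section Coefficients

variable {d : ℕ} {e e' : Fin d → Euc d}

theorem setIntegral_Icc_exp_two_pi_int (n : ℤ) :
    ∫ t in Set.Icc (0 : ℝ) 1, Complex.exp (Complex.I * (t * (2 * Real.pi * n) : ℝ)) =
      if n = 0 then 1 else 0 := by
  rw [integral_Icc_eq_integral_Ioc, ← intervalIntegral.integral_of_le zero_le_one]
  split_ifs with hn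
  · simp [hn]
  · have hc : (2 * Real.pi * n * Complex.I : ℂ) ≠ 0 := by
      simp [hn, Real.pi_ne_zero]
    have h : ∀ t : ℝ, Complex.exp (Complex.I * (t * (2 * Real.pi * n) : ℝ)) =
        Complex.exp ((2 * Real.pi * n * Complex.I : ℂ) * t) := fun t => by
      push_cast
      ring_nf
    simp only [h]
    rw [integral_exp_mul_complex hc]
    have h1 : Complex.exp (2 * Real.pi * n * Complex.I * (1 : ℝ)) = 1 := by
      rw [← Complex.exp_int_mul_two_pi_mul_I n]
      push_cast
      ring_nf
    rw [h1]
    simp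

/-- Averaging over the parallelepiped spanned by `e` is averaging over the unit cube in the
coordinates given by `e`. -/
theorem volume_inv_mul_setIntegral_paraSet (he : LinearIndependent ℝ e) (g : Euc d → ℂ) :
    (((volume (paraSet e)).toReal : ℂ))⁻¹ * ∫ x in paraSet e, g x =
      ∫ t in Set.univ.pi fun _ : Fin d => Set.Icc (0 : ℝ) 1, g (∑ i, t i • e i) := by
  let b := basisOfLinearIndependentOfCardEqFinrank' e he (by simp)
  let T : (Fin d → ℝ) ≃L[ℝ] Euc d := b.equivFun.symm.toContinuousLinearEquiv
  have hT : ∀ t, T t = ∑ i, t i • e i := fun t => by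
    simp [T, b, Module.Basis.equivFun_symm_apply]
  let M : (Fin d → ℝ) ≃ᵐ Euc d := T.toHomeomorph.toMeasurableEquiv
  have hM : ∀ t, M t = ∑ i, t i • e i := hT
  have hpre : M ⁻¹' paraSet e = Set.univ.pi fun _ : Fin d => Set.Icc (0 : ℝ) 1 := by
    have : paraSet e = M '' Set.univ.pi fun _ : Fin d => Set.Icc (0 : ℝ) 1 := by
      simp only [paraSet, hM]
    rw [this, Set.preimage_image_eq _ M.injective]
  have hmap : (Measure.map M volume).IsAddHaarMeasure :=
    ContinuousLinearEquiv.isAddHaarMeasure_map T volume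
  have hvol : (volume : Measure (Euc d)) = _ :=
    Measure.isAddLeftInvariant_eq_smul volume (Measure.map M volume)
  have hpos := Measure.addHaarScalarFactor_pos_of_isAddHaarMeasure
    (volume : Measure (Euc d)) (Measure.map M volume)
  set c := Measure.addHaarScalarFactor (volume : Measure (Euc d)) (Measure.map M volume)
  have hE : Measure.map M volume (paraSet e) = 1 := by
    rw [M.map_apply, hpre, volume_pi_pi]
    simp
  have hI : ∫ x in paraSet e, g x ∂(Measure.map M volume) =
      ∫ t in Set.univ.pi fun _ : Fin d => Set.Icc (0 : ℝ) 1, g (∑ i, t i • e i) := by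
    rw [setIntegral_map_equiv, hpre]
    simp only [hM]
  rw [hvol, Measure.restrict_smul, integral_smul_nnreal_measure, hI, Measure.smul_apply, hE]
  have hc : (c : ℂ) ≠ 0 := by exact_mod_cast hpos.ne'
  simp [NNReal.smul_def, hc, ENNReal.smul_def]

theorem setIntegral_cube_exp_inner_latPt
    (hdual : ∀ j k, ⟪e j, e' k⟫_ℝ = if j = k then 2 * Real.pi else 0) (ι : Fin d → ℤ) :
    ∫ t in Set.univ.pi fun _ : Fin d => Set.Icc (0 : ℝ) 1,
      Complex.exp (Complex.I * (⟪∑ i, t i • e i, latPt e' ι⟫_ℝ : ℂ)) =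
        if ι = 0 then 1 else 0 := by
  have h : ∀ t : Fin d → ℝ,
      Complex.exp (Complex.I * (⟪∑ i, t i • e i, latPt e' ι⟫_ℝ : ℂ)) =
        ∏ i, Complex.exp (Complex.I * (t i * (2 * Real.pi * ι i) : ℝ)) := fun t => by
    rw [inner_sum_smul_latPt hdual, Complex.ofReal_sum, Finset.mul_sum, Complex.exp_sum]
  simp only [h]
  rw [volume_pi, Measure.restrict_pi_pi, integral_fintype_prod_eq_prod
    (f := fun i (t : ℝ) => Complex.exp (Complex.I * (t * (2 * Real.pi * ι i) : ℝ)))]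
  simp only [setIntegral_Icc_exp_two_pi_int, Finset.prod_ite_zero]
  simp [funext_iff]

theorem latPt_sub (κ ι : Fin d → ℤ) : latPt e' (κ - ι) = latPt e' κ - latPt e' ι := by
  simp [latPt, sub_smul]

theorem fourCoeff_perSum (he : LinearIndependent ℝ e)
    (hdual : ∀ j k, ⟪e j, e' k⟫_ℝ = if j = k then 2 * Real.pi else 0)
    {a : (Fin d → ℤ) → ℂ} (ha : Summable fun ι => ‖a ι‖) (ι : Fin d → ℤ) :
    fourCoeff e (perSum e' a) (latPt e' ι) = a ι := by
  rw [fourCoeff, volume_inv_mul_setIntegral_paraSet he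
    fun x => perSum e' a x * Complex.exp (-Complex.I * (⟪x, latPt e' ι⟫_ℝ : ℂ))]
  have hcongr : ∀ t : Fin d → ℝ, perSum e' a (∑ i, t i • e i) *
      Complex.exp (-Complex.I * (⟪∑ i, t i • e i, latPt e' ι⟫_ℝ : ℂ)) =
      ∑' κ, a κ * Complex.exp (Complex.I * (⟪∑ i, t i • e i, latPt e' (κ - ι)⟫_ℝ : ℂ)) := by
    intro t
    rw [perSum, ← tsum_mul_right]
    refine tsum_congr fun κ => ?_
    rw [mul_assoc, ← Complex.exp_add, latPt_sub, inner_sub_right]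
    push_cast
    ring_nf
  simp only [hcongr]
  have hfin : volume (Set.univ.pi fun _ : Fin d => Set.Icc (0 : ℝ) 1) = 1 := by
    rw [volume_pi_pi]
    simp
  have hint : ∀ κ, IntegrableOn (fun t : Fin d → ℝ => a κ *
      Complex.exp (Complex.I * (⟪∑ i, t i • e i, latPt e' (κ - ι)⟫_ℝ : ℂ)))
      (Set.univ.pi fun _ : Fin d => Set.Icc (0 : ℝ) 1) := fun κ =>
    ContinuousOn.integrableOn_compact (isCompact_univ_pi fun _ => isCompact_Icc)
      (by fun_prop)
  rw [← integral_tsum_of_summable_integral_norm hint]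
  · simp only [integral_const_mul, setIntegral_cube_exp_inner_latPt hdual, sub_eq_zero]
    simp
  · simpa only [norm_mul, norm_exp_I_mul_inner, mul_one, setIntegral_const, measureReal_def, hfin,
      ENNReal.toReal_one, one_smul] using ha

theorem perSum_add_latPt
    (hdual : ∀ j k, ⟪e j, e' k⟫_ℝ = if j = k then 2 * Real.pi else 0)
    (a : (Fin d → ℤ) → ℂ) (x : Euc d) (j : Fin d → ℤ) :
    perSum e' a (x + latPt e j) = perSum e' a x := by
  refine tsum_congr fun ι => ?_
  have h : ⟪latPt e j, latPt e' ι⟫_ℝ = ((∑ i, j i * ι i : ℤ) : ℝ) * (2 * Real.pi) := by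
    rw [latPt, inner_sum_smul_latPt hdual]
    push_cast
    rw [Finset.sum_mul]
    exact Finset.sum_congr rfl fun i _ => by ring
  have h1 : Complex.exp (Complex.I * (⟪latPt e j, latPt e' ι⟫_ℝ : ℂ)) = 1 := by
    rw [h, ← Complex.exp_int_mul_two_pi_mul_I (∑ i, j i * ι i)]
    push_cast
    ring_nf
  rw [inner_add_left, Complex.ofReal_add, mul_add, Complex.exp_add, h1, mul_one]

end Coefficients

/-- if the coefficients decay like `C e^{-r|α|^{1/s}}` then the Fourier series
converges absolutely and uniformly, its sum is a smooth `E`-periodic function which can be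
differentiated termwise, its Fourier coefficients are the given ones, and it satisfies a
Roumieu–Gevrey-`s` estimate. -/
theorem fourier_series_of_gevrey_coeff
    {d : ℕ} (hd : 1 ≤ d) (s : ℝ) (hs : 0 < s)
    (e e' : Fin d → Euc d) (he : LinearIndependent ℝ e)
    (hdual : ∀ j k, ⟪e j, e' k⟫_ℝ = if j = k then 2 * Real.pi else 0)
    (a : (Fin d → ℤ) → ℂ) (C r : ℝ) (hC : 0 < C) (hr : 0 < r)
    (ha : ∀ ι : Fin d → ℤ, ‖a ι‖ ≤ C * Real.exp (-r * ‖latPt e' ι‖ ^ (1/s))) :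
    (∀ x : Euc d, Summable fun ι : Fin d → ℤ =>
        ‖a ι * Complex.exp (Complex.I * (⟪x, latPt e' ι⟫_ℝ : ℂ))‖) ∧
    TendstoUniformly
      (fun (F : Finset (Fin d → ℤ)) (x : Euc d) =>
        ∑ ι ∈ F, a ι * Complex.exp (Complex.I * (⟪x, latPt e' ι⟫_ℝ : ℂ)))
      (perSum e' a) atTop ∧
    ContDiff ℝ (⊤ : ℕ∞) (perSum e' a) ∧
    (∀ (x : Euc d) (j : Fin d → ℤ), perSum e' a (x + latPt e j) = perSum e' a x) ∧
    (∀ (β : Fin d → ℕ) (x : Euc d),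
        pD β (perSum e' a) x =
          ∑' ι : Fin d → ℤ,
            pD β (fun y => a ι * Complex.exp (Complex.I * (⟪y, latPt e' ι⟫_ℝ : ℂ))) x) ∧
    (∀ ι : Fin d → ℤ, fourCoeff e (perSum e' a) (latPt e' ι) = a ι) ∧
    (∃ C' h : ℝ, 0 < C' ∧ 0 < h ∧ ∀ (β : Fin d → ℕ) (x : Euc d),
        ‖pD β (perSum e' a) x‖ ≤ C' * h ^ (∑ i, β i) * (((∏ i, (β i).factorial : ℕ) : ℝ)) ^ s) := by

  have he' := linearIndependent_of_dual hdual
  have hinj := latPt_injective hdual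
  have hdec := rapidDecay_of_gevrey hd hs he' hinj hC hr ha
  refine ⟨hdec.summable_norm_mul_exp, ?_, hdec.contDiff_tsum, perSum_add_latPt hdual a, ?_,
    fourCoeff_perSum he hdual hdec.summable_norm, ?_⟩
  · refine tendstoUniformly_tsum hdec.summable_norm fun ι x => ?_
    rw [norm_mul, norm_exp_I_mul_inner, mul_one]
  · intro β x
    simp only [pD, pdSeq_mul_exp_I_inner]
    exact congrFun (hdec.pdSeq_tsum (mIdxL β)) x
  · have hsum := summable_exp_neg_norm_latPt_rpow hs he' hinj (half_pos hr)
    set S := ∑' ι : Fin d → ℤ, Real.exp (-(r / 2) * ‖latPt e' ι‖ ^ (1 / s)) with hS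
    have hS0 : 0 < S := hsum.tsum_pos (fun _ => (Real.exp_pos _).le) 0 (Real.exp_pos _)
    have hd' : (0 : ℝ) < d := by exact_mod_cast hd
    refine ⟨C * S, (d * s / (r / 2)) ^ s, by positivity, by positivity, fun β x => ?_⟩
    have hx : pD β (perSum e' a) x = _ := congrFun (hdec.pdSeq_tsum (mIdxL β)) x
    rw [hx]
    refine (tsum_of_norm_bounded (hsum.hasSum.mul_left
      (C * ((d * s / (r / 2)) ^ s) ^ (∑ i, β i) *
        ((∏ i, (β i).factorial : ℕ) : ℝ) ^ s)) fun ι => ?_).trans_eq (by rw [hS]; ring)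
    refine le_trans ?_ (norm_mul_pow_sum_le hd hs hC hr ha β ι)
    rw [norm_mul, norm_mul, norm_exp_I_mul_inner, mul_one, ← length_mIdxL]
    gcongr
    exact norm_dirSymbol_le _ _

end
end

section
/- Let d ≥ 1, s, t > 0 with s + t ≥ 1, E ⊆ ℝ^d be a non-degenerate parallelepiped, and let φ : ℝ^d → ℂ be a nonzero continuous integrable function for which there exist C₀, r₀ > 0 with |φ(x)| ≤ C₀ e^{-r₀|x|^{1/t}} and |φ̂(ξ)| ≤ C₀ e^{-r₀|ξ|^{1/s}} for all x, ξ ∈ ℝ^d. Let f be a smooth E-periodic function on ℝ^d. Then there exist constants C, r > 0 with |V_φf(x,ξ)| ≤ C e^{-r|ξ|^{1/s}} for all (x,ξ) ∈ ℝ^d × ℝ^d if and only if there exist constants C', r' > 0 with |c(f,α)| ≤ C' e^{-r'|α|^{1/s}} for all α ∈ Λ'_E. -/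
open MeasureTheory Filter
open scoped BigOperators InnerProductSpace Topology

noncomputable section

/-- The linear coordinates attached to a family of `d` independent vectors. -/
def coordEquiv {d : ℕ} (e : Fin d → Euc d) (he : LinearIndependent ℝ e) :
    (Fin d → ℝ) ≃L[ℝ] Euc d :=
  (basisOfLinearIndependentOfCardEqFinrank' e he
    (by simp)).equivFun.symm.toContinuousLinearEquiv

lemma coordEquiv_apply {d : ℕ} (e : Fin d → Euc d) (he : LinearIndependent ℝ e)
    (t : Fin d → ℝ) : coordEquiv e he t = ∑ i, t i • e i := by
  simp [coordEquiv, Module.Basis.equivFun_symm_apply]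

/-- The half-open unit cube. -/
def unitCube (d : ℕ) : Set (Fin d → ℝ) := {t | ∀ i, t i ∈ Set.Ioc (0 : ℝ) (0 + 1)}

lemma unitCube_eq_pi (d : ℕ) : unitCube d = Set.univ.pi fun _ => Set.Ioc (0 : ℝ) 1 := by
  ext t; simp [unitCube]

lemma volume_unitCube (d : ℕ) : volume (unitCube d) = 1 := by
  rw [unitCube_eq_pi, volume_pi_pi]; simp

instance {d : ℕ} : IsProbabilityMeasure (volume.restrict (unitCube d)) :=
  ⟨by rw [Measure.restrict_apply_univ, volume_unitCube]⟩

lemma unitCube_ae_eq_Icc (d : ℕ) :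
    unitCube d =ᵐ[volume] Set.univ.pi fun _ => Set.Icc (0 : ℝ) 1 := by
  rw [unitCube_eq_pi, volume_pi]
  exact Measure.pi_Ioc_ae_eq_pi_Icc (s := Set.univ) (f := fun _ => (0 : ℝ)) (g := fun _ => 1)

/-- A continuous `ℤ^d`-periodic function descends to the torus. -/
lemma exists_torus_lift {d : ℕ} (g : (Fin d → ℝ) → ℂ) (hg : Continuous g)
    (hper : ∀ (x : Fin d → ℝ) (j : Fin d → ℤ), g (x + fun i => (j i : ℝ)) = g x) :
    ∃ F : C(UnitAddTorus (Fin d), ℂ), ∀ x : Fin d → ℝ, F (fun i => (x i : UnitAddCircle)) = g x := by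
  let π : (Fin d → ℝ) → UnitAddTorus (Fin d) := Pi.map fun _ => ((↑) : ℝ → UnitAddCircle)
  have hπ : IsOpenQuotientMap π :=
    IsOpenQuotientMap.piMap fun _ => QuotientAddGroup.isOpenQuotientMap_mk
  have hfac : ∀ x y, π x = π y → g x = g y := by
    intro x y hxy
    have : ∀ i, ∃ n : ℤ, y i + n = x i := by
      intro i
      have h := congrFun hxy i
      simp only [π, Pi.map_apply] at h
      obtain ⟨n, hn⟩ := (AddCircle.coe_eq_zero_iff (1 : ℝ)).1
        ((AddCircle.coe_sub 1 _ _).trans (sub_eq_zero.2 h))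
      exact ⟨n, by simp at hn; linarith⟩
    choose n hn using this
    rw [← hper y n]
    congr 1
    ext i
    simp [hn]
  have hF : ∀ x, g (Function.surjInv hπ.surjective (π x)) = g x := fun x =>
    hfac _ _ (Function.surjInv_eq hπ.surjective _)
  refine ⟨⟨fun z => g (Function.surjInv hπ.surjective z), ?_⟩, fun x => hF x⟩
  rw [hπ.isQuotientMap.continuous_iff]
  exact hg.congr fun x => (hF x).symm

lemma setIntegral_unitCube_add {d : ℕ} (g : (Fin d → ℝ) → ℂ) (hg : Continuous g)
    (hper : ∀ (x : Fin d → ℝ) (j : Fin d → ℤ), g (x + fun i => (j i : ℝ)) = g x)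
    (a : Fin d → ℝ) : ∫ t in unitCube d, g (t + a) = ∫ t in unitCube d, g t := by
  obtain ⟨F, hF⟩ := exists_torus_lift g hg hper
  have h := (UnitAddTorus.integral_preimage F 0).symm.trans (UnitAddTorus.integral_preimage F a)
  simp only [hF] at h
  change ∫ t in unitCube d, g t = _ at h
  rw [h, ← (measurePreserving_add_right volume a).setIntegral_preimage_emb
    (measurableEmbedding_addRight a) g]
  congr 2
  ext t
  simp only [unitCube, Set.mem_ofPred_eq, Set.mem_preimage, Pi.add_apply, Set.mem_Ioc]
  refine forall_congr' fun i => ?_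
  constructor <;> rintro ⟨h1, h2⟩ <;> constructor <;> linarith

lemma setAverage_paraSet {d : ℕ} (e : Fin d → Euc d) (he : LinearIndependent ℝ e)
    (h : Euc d → ℂ) :
    (((volume (paraSet e)).toReal : ℂ))⁻¹ * ∫ x in paraSet e, h x =
      ∫ t in unitCube d, h (coordEquiv e he t) := by
  set L := coordEquiv e he
  have hpre : paraSet e = L.symm ⁻¹' (Set.univ.pi fun _ => Set.Icc (0 : ℝ) 1) := by
    rw [← L.image_eq_preimage_symm, paraSet]
    exact Set.image_congr fun t _ => (coordEquiv_apply e he t).symm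
  have := L.symm.isAddHaarMeasure_map (volume : Measure (Euc d))
  obtain ⟨c, hc0, hc⟩ : ∃ c : NNReal, c ≠ 0 ∧
      Measure.map L.symm (volume : Measure (Euc d)) = c • volume :=
    ⟨_, (Measure.addHaarScalarFactor_pos_of_isAddHaarMeasure _ _).ne',
      Measure.isAddLeftInvariant_eq_smul _ _⟩
  have hemb : MeasurableEmbedding L.symm := L.symm.toHomeomorph.measurableEmbedding
  have hvol : volume (paraSet e) = c := by
    rw [hpre, ← hemb.map_apply, hc, Measure.smul_apply, ← measure_congr (unitCube_ae_eq_Icc d),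
      volume_unitCube, ENNReal.smul_def, smul_eq_mul, mul_one]
  have hintegral : ∫ x in paraSet e, h x = (c : ℝ) • ∫ t in unitCube d, h (L t) := by
    rw [setIntegral_congr_set (unitCube_ae_eq_Icc d), ← NNReal.smul_def,
      ← integral_smul_nnreal_measure, ← Measure.restrict_smul, ← hc, hemb.setIntegral_map, hpre]
    simp
  rw [hvol, hintegral, Complex.real_smul, ENNReal.coe_toReal, inv_mul_cancel_left₀]
  simpa using hc0


/-- The plane wave `x ↦ e^{i⟨x,ξ⟩}`. -/
def planeWave {d : ℕ} (ξ x : Euc d) : ℂ := Complex.exp (Complex.I * (⟪x, ξ⟫_ℝ : ℂ))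

lemma planeWave_neg {d : ℕ} (ξ x : Euc d) :
    planeWave (-ξ) x = Complex.exp (-(Complex.I) * (⟪x, ξ⟫_ℝ : ℂ)) := by
  simp [planeWave, inner_neg_right]

@[fun_prop]
lemma continuous_planeWave {d : ℕ} (ξ : Euc d) : Continuous (planeWave ξ) := by
  unfold planeWave; fun_prop

@[simp]
lemma norm_planeWave {d : ℕ} (ξ x : Euc d) : ‖planeWave ξ x‖ = 1 := by
  rw [planeWave, mul_comm, Complex.norm_exp_ofReal_mul_I]

lemma planeWave_add {d : ℕ} (ξ x y : Euc d) :
    planeWave ξ (x + y) = planeWave ξ x * planeWave ξ y := by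
  simp [planeWave, inner_add_left, mul_add, Complex.exp_add]

lemma planeWave_add_freq {d : ℕ} (ξ η x : Euc d) :
    planeWave (ξ + η) x = planeWave ξ x * planeWave η x := by
  simp [planeWave, inner_add_right, mul_add, Complex.exp_add]

lemma planeWave_neg_mul_self {d : ℕ} (ξ x : Euc d) : planeWave (-ξ) x * planeWave ξ x = 1 := by
  rw [← planeWave_add_freq]; simp [planeWave]

lemma conj_planeWave {d : ℕ} (ξ x : Euc d) :
    (starRingEnd ℂ) (planeWave ξ x) = planeWave (-ξ) x := by
  rw [planeWave_neg, planeWave, ← Complex.exp_conj]; simp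

lemma fourCoeff_eq_integral_unitCube {d : ℕ} (e : Fin d → Euc d) (he : LinearIndependent ℝ e)
    (f : Euc d → ℂ) (ξ : Euc d) :
    fourCoeff e f ξ = ∫ t in unitCube d, f (coordEquiv e he t) *
      planeWave (-ξ) (coordEquiv e he t) := by
  simp_rw [fourCoeff, ← planeWave_neg]
  exact setAverage_paraSet e he fun x => f x * planeWave (-ξ) x

lemma norm_fourCoeff_le {d : ℕ} (e : Fin d → Euc d) (he : LinearIndependent ℝ e)
    {g : Euc d → ℂ} {M : ℝ} (hg : ∀ x, ‖g x‖ ≤ M) (ξ : Euc d) : ‖fourCoeff e g ξ‖ ≤ M := by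
  rw [fourCoeff_eq_integral_unitCube e he]
  refine (norm_integral_le_of_norm_le_const (C := M) (ae_of_all _ fun t => ?_)).trans ?_
  · simpa using hg _
  · simp

lemma latPt_eq_coordEquiv {d : ℕ} (e : Fin d → Euc d) (he : LinearIndependent ℝ e)
    (j : Fin d → ℤ) : latPt e j = coordEquiv e he fun i => (j i : ℝ) := by
  rw [coordEquiv_apply, latPt]

lemma inner_coordEquiv_latPt {d : ℕ} {e e' : Fin d → Euc d} (he : LinearIndependent ℝ e)
    (hdual : ∀ j k, ⟪e j, e' k⟫_ℝ = if j = k then 2 * Real.pi else 0)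
    (t : Fin d → ℝ) (ι : Fin d → ℤ) :
    ⟪coordEquiv e he t, latPt e' ι⟫_ℝ = ∑ i, 2 * Real.pi * ι i * t i := by
  rw [coordEquiv_apply, latPt, sum_inner]
  refine Finset.sum_congr rfl fun i _ => ?_
  rw [inner_sum, Finset.sum_eq_single i]
  · rw [inner_smul_left, inner_smul_right, hdual, if_pos rfl]
    simp; ring
  · intro b _ hb
    rw [inner_smul_left, inner_smul_right, hdual, if_neg hb.symm]
    simp
  · simp

lemma planeWave_latPt {d : ℕ} {e e' : Fin d → Euc d} (he : LinearIndependent ℝ e)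
    (hdual : ∀ j k, ⟪e j, e' k⟫_ℝ = if j = k then 2 * Real.pi else 0)
    (t : Fin d → ℝ) (ι : Fin d → ℤ) :
    planeWave (latPt e' ι) (coordEquiv e he t) =
      UnitAddTorus.mFourier ι fun i => (t i : UnitAddCircle) := by
  rw [planeWave, inner_coordEquiv_latPt he hdual]
  simp only [UnitAddTorus.mFourier, ContinuousMap.coe_mk, fourier_coe_apply]
  rw [← Complex.exp_sum]
  congr 1
  push_cast
  rw [Finset.mul_sum]
  refine Finset.sum_congr rfl fun i _ => ?_
  ring

lemma neg_latPt {d : ℕ} (e : Fin d → Euc d) (ι : Fin d → ℤ) : -latPt e ι = latPt e (-ι) := by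
  simp [latPt]

lemma planeWave_latPt_add {d : ℕ} {e e' : Fin d → Euc d} (he : LinearIndependent ℝ e)
    (hdual : ∀ j k, ⟪e j, e' k⟫_ℝ = if j = k then 2 * Real.pi else 0)
    (ι j : Fin d → ℤ) (x : Euc d) :
    planeWave (latPt e' ι) (x + latPt e j) = planeWave (latPt e' ι) x := by
  have h0 : (fun i => ((j i : ℝ) : UnitAddCircle)) = 0 := by
    ext i
    exact (AddCircle.coe_eq_zero_iff (1 : ℝ)).2 ⟨j i, by simp⟩
  rw [planeWave_add, latPt_eq_coordEquiv e he, planeWave_latPt he hdual, h0]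
  simp [UnitAddTorus.mFourier]

/-- A continuous periodic function, read in lattice coordinates, descends to the torus. -/
lemma exists_torus_lift_coordEquiv {d : ℕ} {e : Fin d → Euc d} (he : LinearIndependent ℝ e)
    {f : Euc d → ℂ} (hf : Continuous f)
    (hper : ∀ (x : Euc d) (j : Fin d → ℤ), f (x + latPt e j) = f x) :
    ∃ F : C(UnitAddTorus (Fin d), ℂ),
      ∀ t : Fin d → ℝ, F (fun i => (t i : UnitAddCircle)) = f (coordEquiv e he t) := by
  refine exists_torus_lift (fun t => f (coordEquiv e he t))
    (hf.comp (coordEquiv e he).continuous) fun t j => ?_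
  rw [map_add, ← latPt_eq_coordEquiv, hper]

lemma exists_norm_le_of_periodic {d : ℕ} {e : Fin d → Euc d} (he : LinearIndependent ℝ e)
    {f : Euc d → ℂ} (hf : Continuous f)
    (hper : ∀ (x : Euc d) (j : Fin d → ℤ), f (x + latPt e j) = f x) :
    ∃ M, ∀ x, ‖f x‖ ≤ M := by
  obtain ⟨F, hF⟩ := exists_torus_lift_coordEquiv he hf hper
  refine ⟨‖F‖, fun x => ?_⟩
  have := hF ((coordEquiv e he).symm x)
  rw [ContinuousLinearEquiv.apply_symm_apply] at this
  exact this ▸ F.norm_coe_le_norm _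

/-- A continuous periodic function with summable Fourier coefficients is the sum of its
Fourier series. -/
lemma hasSum_fourCoeff_planeWave {d : ℕ} {e e' : Fin d → Euc d} (he : LinearIndependent ℝ e)
    (hdual : ∀ j k, ⟪e j, e' k⟫_ℝ = if j = k then 2 * Real.pi else 0)
    {f : Euc d → ℂ} (hf : Continuous f)
    (hper : ∀ (x : Euc d) (j : Fin d → ℤ), f (x + latPt e j) = f x)
    (hsum : Summable fun ι => fourCoeff e f (latPt e' ι)) (x : Euc d) :
    HasSum (fun ι => fourCoeff e f (latPt e' ι) * planeWave (latPt e' ι) x) (f x) := by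
  obtain ⟨F, hF⟩ := exists_torus_lift_coordEquiv he hf hper
  have hcoef : UnitAddTorus.mFourierCoeff F = fun ι => fourCoeff e f (latPt e' ι) := by
    ext ι
    rw [UnitAddTorus.mFourierCoeff_eq_integral F ι 0, fourCoeff_eq_integral_unitCube e he]
    simp only [hF, ← planeWave_latPt he hdual, neg_latPt, smul_eq_mul, unitCube, mul_comm,
      Pi.zero_apply]
  have h := UnitAddTorus.hasSum_mFourier_series_apply_of_summable (f := F) (hcoef ▸ hsum)
    fun i => ((coordEquiv e he).symm x i : UnitAddCircle)
  simpa only [hcoef, hF, ← planeWave_latPt he hdual, ContinuousLinearEquiv.apply_symm_apply,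
    smul_eq_mul] using h

lemma integral_unitCube_translate {d : ℕ} {e e' : Fin d → Euc d} (he : LinearIndependent ℝ e)
    (hdual : ∀ j k, ⟪e j, e' k⟫_ℝ = if j = k then 2 * Real.pi else 0)
    {f : Euc d → ℂ} (hf : Continuous f)
    (hper : ∀ (x : Euc d) (j : Fin d → ℤ), f (x + latPt e j) = f x) (ι : Fin d → ℤ)
    (y : Euc d) :
    ∫ t in unitCube d, f (coordEquiv e he t + y) * planeWave (-latPt e' ι) (coordEquiv e he t) =
      planeWave (latPt e' ι) y * fourCoeff e f (latPt e' ι) := by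
  set L := coordEquiv e he with hL
  have h := setIntegral_unitCube_add
    (fun t => f (L t) * planeWave (-latPt e' ι) (L t))
    (by have := L.continuous; fun_prop)
    (fun t j => by
      simp only [map_add, hL, ← latPt_eq_coordEquiv, hper, neg_latPt,
        planeWave_latPt_add he hdual]) (L.symm y)
  rw [fourCoeff_eq_integral_unitCube e he, ← h, ← integral_const_mul]
  congr 1
  ext t
  rw [map_add, L.apply_symm_apply, planeWave_add]
  linear_combination (-(f (L t + y)) * planeWave (-latPt e' ι) (L t)) *
    planeWave_neg_mul_self (latPt e' ι) y

/-- The Fourier coefficients of the correlation of a periodic function with an integrable one. -/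
lemma fourCoeff_correlation {d : ℕ} {e e' : Fin d → Euc d} (he : LinearIndependent ℝ e)
    (hdual : ∀ j k, ⟪e j, e' k⟫_ℝ = if j = k then 2 * Real.pi else 0)
    {f : Euc d → ℂ} (hf : Continuous f)
    (hper : ∀ (x : Euc d) (j : Fin d → ℤ), f (x + latPt e j) = f x)
    {ψ : Euc d → ℂ} (hψ : Integrable ψ) (ι : Fin d → ℤ) :
    fourCoeff e (fun x => ∫ y, f (x + y) * ψ y) (latPt e' ι) =
      (∫ y, planeWave (latPt e' ι) y * ψ y) * fourCoeff e f (latPt e' ι) := by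
  obtain ⟨M, hM⟩ := exists_norm_le_of_periodic he hf hper
  rw [fourCoeff_eq_integral_unitCube e he]
  set L := coordEquiv e he with hL
  have hintegral : Integrable (Function.uncurry fun (t : Fin d → ℝ) (y : Euc d) =>
      f (L t + y) * planeWave (-latPt e' ι) (L t) * ψ y)
      ((volume.restrict (unitCube d)).prod volume) := by
    refine (hψ.comp_snd (volume.restrict (unitCube d))).bdd_mul (c := M)
      (f := fun p : (Fin d → ℝ) × Euc d => f (L p.1 + p.2) * planeWave (-latPt e' ι) (L p.1))
      (Continuous.aestronglyMeasurable (by have := L.continuous; fun_prop))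
      (ae_of_all _ fun p => ?_)
    simpa using hM _
  calc ∫ t in unitCube d, (∫ y, f (L t + y) * ψ y) * planeWave (-latPt e' ι) (L t)
      = ∫ t in unitCube d, ∫ y, f (L t + y) * planeWave (-latPt e' ι) (L t) * ψ y := by
        simp_rw [← integral_mul_const]
        exact integral_congr_ae (ae_of_all _ fun t =>
          integral_congr_ae (ae_of_all _ fun y => mul_right_comm _ _ _))
    _ = ∫ y, ∫ t in unitCube d, f (L t + y) * planeWave (-latPt e' ι) (L t) * ψ y :=
        integral_integral_swap hintegral
    _ = _ := by
        simp_rw [integral_mul_const, hL, integral_unitCube_translate he hdual hf hper]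
        rw [← integral_mul_const]
        congr! 2
        ring

/-- The window, conjugated, normalized and modulated to frequency `-ξ`. -/
def modWindow {d : ℕ} (φ : Euc d → ℂ) (ξ y : Euc d) : ℂ :=
  (((2 * Real.pi) ^ (-(d:ℝ)/2) : ℝ) : ℂ) * ((starRingEnd ℂ) (φ y) * planeWave (-ξ) y)

lemma integrable_modWindow {d : ℕ} {φ : Euc d → ℂ} (hφ : Integrable φ) (ξ : Euc d) :
    Integrable (modWindow φ ξ) := by
  have hc : Integrable fun y => (starRingEnd ℂ) (φ y) :=
    (integrable_norm_iff (by
      exact Complex.continuous_conj.comp_aestronglyMeasurable hφ.aestronglyMeasurable)).1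
      (by simpa using hφ.norm)
  refine (hc.mul_bdd (c := 1) (continuous_planeWave (-ξ)).aestronglyMeasurable
    (ae_of_all _ fun y => ?_)).const_mul _
  simp

lemma STFT_eq {d : ℕ} (φ f : Euc d → ℂ) (x ξ : Euc d) :
    STFT φ f x ξ = planeWave (-ξ) x * ∫ y, f (x + y) * modWindow φ ξ y := by
  rw [STFT, ← integral_const_mul, ← integral_const_mul, ← integral_add_left_eq_self _ x]
  congr! 2 with y
  rw [← planeWave_neg, planeWave_add, modWindow, add_sub_cancel_left]
  ring

lemma norm_STFT {d : ℕ} (φ f : Euc d → ℂ) (x ξ : Euc d) :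
    ‖STFT φ f x ξ‖ = ‖∫ y, f (x + y) * modWindow φ ξ y‖ := by
  simp [STFT_eq]

lemma integral_planeWave_mul_modWindow {d : ℕ} (φ : Euc d → ℂ) (α ξ : Euc d) :
    ∫ y, planeWave α y * modWindow φ ξ y = (starRingEnd ℂ) (FT φ (α - ξ)) := by
  rw [FT, map_mul, Complex.conj_ofReal, ← integral_conj, ← integral_const_mul]
  congr! 2 with y
  rw [← planeWave_neg, map_mul, conj_planeWave, modWindow, neg_neg, sub_eq_add_neg,
    planeWave_add_freq]
  ring

lemma exists_FT_ne_zero {d : ℕ} {φ : Euc d → ℂ} (hφc : Continuous φ) (hφi : Integrable φ)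
    (hφne : φ ≠ 0) : ∃ η, FT φ η ≠ 0 := by
  by_contra! h
  have hK : (((2 * Real.pi) ^ (-(d:ℝ)/2) : ℝ) : ℂ) ≠ 0 := by
    exact_mod_cast (Real.rpow_pos_of_pos Real.two_pi_pos _).ne'
  have hF : FourierTransform.fourier φ = 0 := by
    ext w
    have := (mul_eq_zero.1 (h ((2 * Real.pi) • w))).resolve_left hK
    rw [Real.fourier_eq', Pi.zero_apply, ← this]
    congr! 2 with v
    rw [smul_eq_mul, mul_comm, inner_smul_right]
    congr 2
    push_cast
    ring
  apply hφne
  rw [← hφc.fourierInv_fourier_eq hφi (hF ▸ integrable_zero _ _ _), hF]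
  ext w
  simp [Real.fourierInv_eq']

lemma norm_add_rpow_le {d : ℕ} {p : ℝ} (hp : 0 < p) (a b : Euc d) :
    ‖a + b‖ ^ p ≤ 2 ^ p * (‖a‖ ^ p + ‖b‖ ^ p) := by
  have h : ‖a + b‖ ≤ 2 * max ‖a‖ ‖b‖ :=
    (norm_add_le a b).trans (by linarith [le_max_left ‖a‖ ‖b‖, le_max_right ‖a‖ ‖b‖])
  have ha := Real.rpow_nonneg (norm_nonneg a) p
  have hb := Real.rpow_nonneg (norm_nonneg b) p
  calc ‖a + b‖ ^ p ≤ (2 * max ‖a‖ ‖b‖) ^ p := Real.rpow_le_rpow (norm_nonneg _) h hp.le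
    _ = 2 ^ p * (max ‖a‖ ‖b‖) ^ p := Real.mul_rpow zero_le_two (by positivity)
    _ ≤ _ := by
      gcongr
      rcases max_cases ‖a‖ ‖b‖ with h | h <;> rw [h.1] <;> linarith

lemma exp_neg_rpow_le {r p u : ℝ} (hr : 0 < r) (hu : 0 < u) (k : ℕ) :
    Real.exp (-r * u ^ p) ≤ k.factorial / r ^ k * u ^ (-(p * k)) := by
  have hv : 0 < r * u ^ p := by positivity
  have h := Real.pow_div_factorial_le_exp (r * u ^ p) hv.le k
  have hk : (0 : ℝ) < k.factorial := by positivity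
  rw [neg_mul, Real.exp_neg, Real.rpow_neg hu.le, Real.rpow_mul_natCast hu.le,
    div_mul_eq_mul_div, ← div_eq_mul_inv, div_div, ← mul_pow, mul_comm (u ^ p)]
  rw [inv_le_comm₀ (Real.exp_pos _) (by positivity), inv_div]
  exact h

lemma linearIndependent_dual {d : ℕ} {e e' : Fin d → Euc d}
    (hdual : ∀ j k, ⟪e j, e' k⟫_ℝ = if j = k then 2 * Real.pi else 0) :
    LinearIndependent ℝ e' := by
  rw [Fintype.linearIndependent_iff]
  intro g hg i
  have h : ⟪e i, ∑ k, g k • e' k⟫_ℝ = 0 := by rw [hg, inner_zero_right]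
  rw [inner_sum, Finset.sum_eq_single i (fun k _ hk => by
    rw [inner_smul_right, hdual, if_neg hk.symm, mul_zero]) (by simp), inner_smul_right, hdual,
    if_pos rfl] at h
  exact (mul_eq_zero.1 h).resolve_right Real.two_pi_pos.ne'

lemma summable_exp_neg_norm_latPt {d : ℕ} {e : Fin d → Euc d} (he : LinearIndependent ℝ e)
    {r p : ℝ} (hr : 0 < r) (hp : 0 < p) :
    Summable fun ι : Fin d → ℤ => Real.exp (-r * ‖latPt e ι‖ ^ p) := by
  let b := basisOfLinearIndependentOfCardEqFinrank' e he (by simp)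
  let L := Submodule.span ℤ (Set.range b)
  obtain ⟨k, hk⟩ := exists_nat_gt ((Module.finrank ℤ L : ℝ) / p)
  have hk' : -(p * k) < -(Module.finrank ℤ L : ℝ) := by
    rw [div_lt_iff₀ hp] at hk; linarith
  have hmem : ∀ ι : Fin d → ℤ, latPt e ι ∈ L := fun ι => by
    refine Submodule.sum_mem _ fun i _ => ?_
    rw [Int.cast_smul_eq_zsmul]
    exact Submodule.smul_mem _ _ (Submodule.subset_span ⟨i, by simp [b]⟩)
  have hinj : Function.Injective (latPt e) := fun ι κ h => by
    rw [latPt_eq_coordEquiv e he, latPt_eq_coordEquiv e he] at h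
    ext i
    exact_mod_cast congrFun ((coordEquiv e he).injective h) i
  have hs := ((ZLattice.summable_norm_rpow L _ hk').comp_injective
    (i := fun ι => (⟨latPt e ι, hmem ι⟩ : L))
    fun ι κ h => hinj (congrArg Subtype.val h)).mul_left (k.factorial / r ^ k)
  refine Summable.of_norm_bounded_eventually hs ?_
  filter_upwards [(Set.finite_singleton (0 : Fin d → ℤ)).compl_mem_cofinite] with ι hι
  rw [Real.norm_of_nonneg (Real.exp_pos _).le]
  refine exp_neg_rpow_le hr (norm_pos_iff.2 fun h => hι ?_) k
  exact hinj (h.trans (by simp [latPt]))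

/-- **Decay transfer from the STFT to the Fourier coefficients.** -/
lemma coeff_decay_of_stft_decay {d : ℕ} {e e' : Fin d → Euc d} (he : LinearIndependent ℝ e)
    (hdual : ∀ j k, ⟪e j, e' k⟫_ℝ = if j = k then 2 * Real.pi else 0)
    {φ : Euc d → ℂ} (hφc : Continuous φ) (hφi : Integrable φ) (hφne : φ ≠ 0)
    {f : Euc d → ℂ} (hf : Continuous f)
    (hper : ∀ (x : Euc d) (j : Fin d → ℤ), f (x + latPt e j) = f x)
    {p C r : ℝ} (hp : 0 < p) (hC : 0 < C) (hr : 0 < r)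
    (h : ∀ x ξ : Euc d, ‖STFT φ f x ξ‖ ≤ C * Real.exp (-r * ‖ξ‖ ^ p)) :
    ∃ C' r' : ℝ, 0 < C' ∧ 0 < r' ∧ ∀ ι : Fin d → ℤ,
      ‖fourCoeff e f (latPt e' ι)‖ ≤ C' * Real.exp (-r' * ‖latPt e' ι‖ ^ p) := by
  obtain ⟨η, hη⟩ := exists_FT_ne_zero hφc hφi hφne
  have hη' := norm_pos_iff.2 hη
  refine ⟨C * Real.exp (r * ‖η‖ ^ p) / ‖FT φ η‖, r / 2 ^ p, by positivity, by positivity,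
    fun ι => ?_⟩
  set α := latPt e' ι with hα
  have hle := norm_fourCoeff_le e he (g := fun x => ∫ y, f (x + y) * modWindow φ (α - η) y)
    (fun x => (norm_STFT φ f x (α - η)).symm.le.trans (h x (α - η))) α
  rw [hα, fourCoeff_correlation he hdual hf hper (integrable_modWindow hφi _), ← hα,
    integral_planeWave_mul_modWindow, norm_mul, RCLike.norm_conj, sub_sub_cancel] at hle
  have hexp : -r * ‖α - η‖ ^ p ≤ r * ‖η‖ ^ p + -(r / 2 ^ p) * ‖α‖ ^ p := by
    have h2 := norm_add_rpow_le hp (α - η) η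
    rw [sub_add_cancel] at h2
    have : r / 2 ^ p * ‖α‖ ^ p ≤ r * (‖α - η‖ ^ p + ‖η‖ ^ p) := by
      rw [div_mul_eq_mul_div, div_le_iff₀ (by positivity)]
      nlinarith
    linarith
  rw [div_mul_eq_mul_div, le_div_iff₀ hη', mul_comm, mul_assoc, ← Real.exp_add]
  exact hle.trans (by gcongr)

/-- **Decay transfer from the Fourier coefficients to the STFT.** -/
lemma stft_decay_of_coeff_decay {d : ℕ} {e e' : Fin d → Euc d} (he : LinearIndependent ℝ e)
    (hdual : ∀ j k, ⟪e j, e' k⟫_ℝ = if j = k then 2 * Real.pi else 0)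
    {φ : Euc d → ℂ} (hφi : Integrable φ)
    {f : Euc d → ℂ} (hf : Continuous f)
    (hper : ∀ (x : Euc d) (j : Fin d → ℤ), f (x + latPt e j) = f x)
    {p C₀ r₀ C r : ℝ} (hp : 0 < p) (hC₀ : 0 < C₀) (hr₀ : 0 < r₀) (hC : 0 < C) (hr : 0 < r)
    (hφF : ∀ ξ : Euc d, ‖FT φ ξ‖ ≤ C₀ * Real.exp (-r₀ * ‖ξ‖ ^ p))
    (h : ∀ ι : Fin d → ℤ,
      ‖fourCoeff e f (latPt e' ι)‖ ≤ C * Real.exp (-r * ‖latPt e' ι‖ ^ p)) :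
    ∃ C' r' : ℝ, 0 < C' ∧ 0 < r' ∧ ∀ x ξ : Euc d,
      ‖STFT φ f x ξ‖ ≤ C' * Real.exp (-r' * ‖ξ‖ ^ p) := by
  have he' := linearIndependent_dual hdual
  have hcs : Summable fun ι => ‖fourCoeff e f (latPt e' ι)‖ :=
    .of_nonneg_of_le (fun _ => norm_nonneg _) h
      ((summable_exp_neg_norm_latPt he' hr hp).mul_left C)
  have hS := summable_exp_neg_norm_latPt he' (half_pos hr) hp
  set S := ∑' ι : Fin d → ℤ, Real.exp (-(r / 2) * ‖latPt e' ι‖ ^ p) with hSdef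
  have hSpos : 0 < S := hS.tsum_pos (fun _ => (Real.exp_pos _).le) 0 (Real.exp_pos _)
  set ρ := min (r / 2) r₀ with hρ
  have hρpos : 0 < ρ := by positivity
  refine ⟨C * C₀ * S, ρ / 2 ^ p, by positivity, by positivity, fun x ξ => ?_⟩
  have hψ := integrable_modWindow hφi ξ
  have hwave : ∀ α, Integrable fun y => planeWave α y * modWindow φ ξ y := fun α =>
    hψ.bdd_mul (c := 1) (continuous_planeWave α).aestronglyMeasurable
      (ae_of_all _ fun y => by simp)
  have hsum := hasSum_integral_of_summable_integral_norm
    (F := fun (ι : Fin d → ℤ) y => fourCoeff e f (latPt e' ι) * planeWave (latPt e' ι) x *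
      (planeWave (latPt e' ι) y * modWindow φ ξ y)) (μ := volume)
    (fun ι => (hwave _).const_mul _) (by
      simp only [norm_mul, norm_planeWave, one_mul, mul_one, integral_const_mul]
      exact hcs.mul_right _)
  have hseries : ∀ y, ∑' ι : Fin d → ℤ, fourCoeff e f (latPt e' ι) * planeWave (latPt e' ι) x *
      (planeWave (latPt e' ι) y * modWindow φ ξ y) = f (x + y) * modWindow φ ξ y := fun y => by
    rw [← ((hasSum_fourCoeff_planeWave he hdual hf hper hcs.of_norm (x + y)).mul_right
      (modWindow φ ξ y)).tsum_eq]
    congr! 2 with ι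
    rw [planeWave_add]
    ring
  simp only [hseries, integral_const_mul, integral_planeWave_mul_modWindow] at hsum
  rw [norm_STFT, ← hsum.tsum_eq]
  refine tsum_of_norm_bounded ((hS.hasSum.mul_left (C * C₀)).mul_right
    (Real.exp (-(ρ / 2 ^ p) * ‖ξ‖ ^ p))) fun ι => ?_
  set α := latPt e' ι
  rw [norm_mul, norm_mul, norm_planeWave, mul_one, RCLike.norm_conj]
  refine (mul_le_mul (h ι) (hφF _) (norm_nonneg _) (by positivity)).trans ?_
  have hexp : -r * ‖α‖ ^ p + -r₀ * ‖α - ξ‖ ^ p ≤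
      -(r / 2) * ‖α‖ ^ p + -(ρ / 2 ^ p) * ‖ξ‖ ^ p := by
    have h2 := norm_add_rpow_le hp α (ξ - α)
    rw [add_sub_cancel, norm_sub_rev ξ α] at h2
    have h3 : ρ / 2 ^ p * ‖ξ‖ ^ p ≤ ρ * (‖α‖ ^ p + ‖α - ξ‖ ^ p) := by
      rw [div_mul_eq_mul_div, div_le_iff₀ (by positivity)]
      nlinarith
    have h4 : ρ * ‖α‖ ^ p ≤ r / 2 * ‖α‖ ^ p := by gcongr; exact min_le_left _ _
    have h5 : ρ * ‖α - ξ‖ ^ p ≤ r₀ * ‖α - ξ‖ ^ p := by gcongr; exact min_le_right _ _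
    linarith
  calc C * Real.exp (-r * ‖α‖ ^ p) * (C₀ * Real.exp (-r₀ * ‖α - ξ‖ ^ p))
      = C * C₀ * Real.exp (-r * ‖α‖ ^ p + -r₀ * ‖α - ξ‖ ^ p) := by rw [Real.exp_add]; ring
    _ ≤ C * C₀ * Real.exp (-(r / 2) * ‖α‖ ^ p + -(ρ / 2 ^ p) * ‖ξ‖ ^ p) := by gcongr
    _ = _ := by rw [Real.exp_add]; ring

/-- Roumieu case: for a smooth `E`-periodic `f` and a Gelfand–Shilov-type window
`φ`, the STFT satisfies `|V_φf(x,ξ)| ≤ C e^{-r|ξ|^{1/s}}` for some `C, r > 0` iff the Fourier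
coefficients satisfy `|c(f,α)| ≤ C' e^{-r'|α|^{1/s}}` for some `C', r' > 0`. -/
theorem stft_decay_iff_coeff_decay_roumieu
    {d : ℕ} (hd : 1 ≤ d) (s t : ℝ) (hs : 0 < s) (ht : 0 < t) (hst : 1 ≤ s + t)
    (e e' : Fin d → Euc d) (he : LinearIndependent ℝ e)
    (hdual : ∀ j k, ⟪e j, e' k⟫_ℝ = if j = k then 2 * Real.pi else 0)
    (φ : Euc d → ℂ) (hφc : Continuous φ) (hφi : MeasureTheory.Integrable φ) (hφne : φ ≠ 0)
    (C₀ r₀ : ℝ) (hC₀ : 0 < C₀) (hr₀ : 0 < r₀)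
    (hφ : ∀ x : Euc d, ‖φ x‖ ≤ C₀ * Real.exp (-r₀ * ‖x‖ ^ (1/t)))
    (hφF : ∀ ξ : Euc d, ‖FT φ ξ‖ ≤ C₀ * Real.exp (-r₀ * ‖ξ‖ ^ (1/s)))
    (f : Euc d → ℂ) (hf : ContDiff ℝ (⊤ : ℕ∞) f)
    (hper : ∀ (x : Euc d) (j : Fin d → ℤ), f (x + latPt e j) = f x) :
    (∃ C r : ℝ, 0 < C ∧ 0 < r ∧ ∀ x ξ : Euc d,
        ‖STFT φ f x ξ‖ ≤ C * Real.exp (-r * ‖ξ‖ ^ (1/s)))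
    ↔
    (∃ C' r' : ℝ, 0 < C' ∧ 0 < r' ∧ ∀ ι : Fin d → ℤ,
        ‖fourCoeff e f (latPt e' ι)‖ ≤ C' * Real.exp (-r' * ‖latPt e' ι‖ ^ (1/s))) := by
  have hp : 0 < 1 / s := one_div_pos.2 hs
  constructor
  · rintro ⟨C, r, hC, hr, h⟩
    exact coeff_decay_of_stft_decay he hdual hφc hφi hφne hf.continuous hper hp hC hr h
  · rintro ⟨C, r, hC, hr, h⟩
    exact stft_decay_of_coeff_decay he hdual hφi hf.continuous hper hp hC₀ hr₀ hC hr hφF h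

end
end
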